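/- If ω ∈ Λ⁴V is such that the induced self-adjoint operator ω : Λ²V → Λ²V is positive-semidefinite, then ω = 0. Consequently, for any self-adjoint operator R on Λ²V, the set {ω ∈ Λ⁴V : R + ω is positive-definite} is convex and bounded. -/

import Mathlib

/- Common setup: an abstract model of the second and fourth exterior powers
`Λ²V` and `Λ⁴V` of a real inner product space `V`, with the induced inner
products, the identification of 4-vectors with self-adjoint operators on
`Λ²V`, and the Bianchi map. -/

noncomputable section

open scoped InnerProductSpace

/-- A linear operator on a real inner product space is positive-semidefinite. -/
def IsPosSemidef {E : Type*} [NormedAddCommGroup E] [InnerProductSpace ℝ E]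
    (T : E →ₗ[ℝ] E) : Prop :=
  ∀ v : E, 0 ≤ ⟪T v, v⟫_ℝ

/-- A linear operator on a real inner product space is positive-definite. -/
def IsPosDef {E : Type*} [NormedAddCommGroup E] [InnerProductSpace ℝ E]
    (T : E →ₗ[ℝ] E) : Prop :=
  ∀ v : E, v ≠ 0 → 0 < ⟪T v, v⟫_ℝ

/-- An abstract model of the exterior powers `Λ²V` (the type `E2`) and `Λ⁴V`
(the type `E4`) of a real inner product space `V`:
* `wedge2 X Y` models `X ∧ Y ∈ Λ²V` and `wedge4 X Y Z W` models
  `X ∧ Y ∧ Z ∧ W ∈ Λ⁴V`; both are alternating, and their images span.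
* The inner products are the induced ones, given by Gram determinants.
* `wedge22` models the wedge product `Λ²V × Λ²V → Λ⁴V`.
* `toOp ω` is the self-adjoint operator on `Λ²V` associated to `ω ∈ Λ⁴V`,
  determined by `⟪toOp ω (X ∧ Y), Z ∧ W⟫ = ω(X,Y,Z,W) = ⟪ω, X ∧ Y ∧ Z ∧ W⟫`
  (using the identification of `Λ⁴V` with 4-forms via the inner product). -/
structure ExtModel (V E2 E4 : Type*)
    [NormedAddCommGroup V] [InnerProductSpace ℝ V]
    [NormedAddCommGroup E2] [InnerProductSpace ℝ E2]
    [NormedAddCommGroup E4] [InnerProductSpace ℝ E4] where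
  wedge2 : V →ₗ[ℝ] V →ₗ[ℝ] E2
  wedge4 : V →ₗ[ℝ] V →ₗ[ℝ] V →ₗ[ℝ] V →ₗ[ℝ] E4
  wedge22 : E2 →ₗ[ℝ] E2 →ₗ[ℝ] E4
  toOp : E4 →ₗ[ℝ] E2 →ₗ[ℝ] E2
  wedge2_self : ∀ X : V, wedge2 X X = 0
  wedge4_self₁₂ : ∀ X Z W : V, wedge4 X X Z W = 0
  wedge4_self₂₃ : ∀ X Y W : V, wedge4 X Y Y W = 0
  wedge4_self₃₄ : ∀ X Y Z : V, wedge4 X Y Z Z = 0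
  span_wedge2 : Submodule.span ℝ {σ : E2 | ∃ X Y : V, σ = wedge2 X Y} = ⊤
  span_wedge4 : Submodule.span ℝ {ω : E4 | ∃ X Y Z W : V, ω = wedge4 X Y Z W} = ⊤
  inner_wedge2 : ∀ X Y Z W : V,
    ⟪wedge2 X Y, wedge2 Z W⟫_ℝ = ⟪X, Z⟫_ℝ * ⟪Y, W⟫_ℝ - ⟪X, W⟫_ℝ * ⟪Y, Z⟫_ℝ
  inner_wedge4 : ∀ x y : Fin 4 → V,
    ⟪wedge4 (x 0) (x 1) (x 2) (x 3), wedge4 (y 0) (y 1) (y 2) (y 3)⟫_ℝ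
      = Matrix.det (Matrix.of fun i j : Fin 4 => ⟪x i, y j⟫_ℝ)
  wedge22_spec : ∀ X Y Z W : V, wedge22 (wedge2 X Y) (wedge2 Z W) = wedge4 X Y Z W
  toOp_spec : ∀ (ω : E4) (X Y Z W : V),
    ⟪toOp ω (wedge2 X Y), wedge2 Z W⟫_ℝ = ⟪ω, wedge4 X Y Z W⟫_ℝ

namespace ExtModel

variable {V E2 E4 : Type*} [NormedAddCommGroup V] [InnerProductSpace ℝ V]
  [NormedAddCommGroup E2] [InnerProductSpace ℝ E2]
  [NormedAddCommGroup E4] [InnerProductSpace ℝ E4]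

/-- The Bianchi map: the 4-linear form associated to an operator
`R : Λ²V → Λ²V` by `b(R)(X,Y,Z,W) = (1/3)(⟪R(X∧Y), Z∧W⟫ + ⟪R(Y∧Z), X∧W⟫ +
⟪R(Z∧X), Y∧W⟫)`. -/
def bianchi (M : ExtModel V E2 E4) (R : E2 →ₗ[ℝ] E2) (X Y Z W : V) : ℝ :=
  (1 / 3) * (⟪R (M.wedge2 X Y), M.wedge2 Z W⟫_ℝ + ⟪R (M.wedge2 Y Z), M.wedge2 X W⟫_ℝ
    + ⟪R (M.wedge2 Z X), M.wedge2 Y W⟫_ℝ)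

end ExtModel

namespace ExtModel

variable {V E2 E4 : Type*} [NormedAddCommGroup V] [InnerProductSpace ℝ V]
  [NormedAddCommGroup E2] [InnerProductSpace ℝ E2]
  [NormedAddCommGroup E4] [InnerProductSpace ℝ E4]

lemma wedge4_swap₁₂ (M : ExtModel V E2 E4) (X Y Z W : V) :
    M.wedge4 Y X Z W = -M.wedge4 X Y Z W := by
  have h := M.wedge4_self₁₂ (X + Y) Z W
  simp only [map_add, LinearMap.add_apply, M.wedge4_self₁₂, zero_add, add_zero] at h
  exact eq_neg_of_add_eq_zero_left h

lemma wedge4_swap₂₃ (M : ExtModel V E2 E4) (X Y Z W : V) :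
    M.wedge4 X Z Y W = -M.wedge4 X Y Z W := by
  have h := M.wedge4_self₂₃ X (Y + Z) W
  simp only [map_add, LinearMap.add_apply, M.wedge4_self₂₃, zero_add, add_zero] at h
  exact eq_neg_of_add_eq_zero_left h

lemma wedge4_swap₃₄ (M : ExtModel V E2 E4) (X Y Z W : V) :
    M.wedge4 X Y W Z = -M.wedge4 X Y Z W := by
  have h := M.wedge4_self₃₄ X Y (Z + W)
  simp only [map_add, LinearMap.add_apply, M.wedge4_self₃₄, zero_add, add_zero] at h
  exact eq_neg_of_add_eq_zero_left h

lemma wedge4_pair_swap (M : ExtModel V E2 E4) (X Y Z W : V) :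
    M.wedge4 Z W X Y = M.wedge4 X Y Z W := by
  rw [M.wedge4_swap₂₃ Z X W Y, M.wedge4_swap₃₄ Z X Y W, M.wedge4_swap₁₂ X Z Y W,
    M.wedge4_swap₂₃ X Y Z W]
  simp

lemma wedge4_pair_self (M : ExtModel V E2 E4) (X Y : V) : M.wedge4 X Y X Y = 0 := by
  rw [M.wedge4_swap₂₃ X X Y Y, M.wedge4_self₁₂, neg_zero]

/-- Decomposable bivectors are isotropic for the quadratic form of a 4-vector. -/
lemma inner_toOp_wedge2_add_smul (M : ExtModel V E2 E4) (ω : E4) (X Y Z W : V) (t : ℝ) :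
    ⟪M.toOp ω (M.wedge2 X Y + t • M.wedge2 Z W), M.wedge2 X Y + t • M.wedge2 Z W⟫_ℝ
      = 2 * t * ⟪ω, M.wedge4 X Y Z W⟫_ℝ := by
  simp only [map_add, map_smul, inner_add_left, inner_add_right, real_inner_smul_left,
    real_inner_smul_right, M.toOp_spec, M.wedge4_pair_self, M.wedge4_pair_swap X Y Z W,
    inner_zero_right]
  ring

lemma abs_inner_wedge4_le (M : ExtModel V E2 E4) (R : E2 →ₗ[ℝ] E2) {ω : E4}
    (h : IsPosSemidef (R + M.toOp ω)) (X Y Z W : V) :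
    |⟪ω, M.wedge4 X Y Z W⟫_ℝ| ≤
      (|⟪R (M.wedge2 X Y + (1 : ℝ) • M.wedge2 Z W), M.wedge2 X Y + (1 : ℝ) • M.wedge2 Z W⟫_ℝ|
        + |⟪R (M.wedge2 X Y + (-1 : ℝ) • M.wedge2 Z W),
            M.wedge2 X Y + (-1 : ℝ) • M.wedge2 Z W⟫_ℝ|) / 2 := by
  have hp := h (M.wedge2 X Y + (1 : ℝ) • M.wedge2 Z W)
  have hm := h (M.wedge2 X Y + (-1 : ℝ) • M.wedge2 Z W)
  rw [LinearMap.add_apply, inner_add_left, inner_toOp_wedge2_add_smul] at hp hm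
  have hp' := le_abs_self
    ⟪R (M.wedge2 X Y + (1 : ℝ) • M.wedge2 Z W), M.wedge2 X Y + (1 : ℝ) • M.wedge2 Z W⟫_ℝ
  have hm' := le_abs_self
    ⟪R (M.wedge2 X Y + (-1 : ℝ) • M.wedge2 Z W), M.wedge2 X Y + (-1 : ℝ) • M.wedge2 Z W⟫_ℝ
  have hp₀ := abs_nonneg
    ⟪R (M.wedge2 X Y + (1 : ℝ) • M.wedge2 Z W), M.wedge2 X Y + (1 : ℝ) • M.wedge2 Z W⟫_ℝ
  have hm₀ := abs_nonneg
    ⟪R (M.wedge2 X Y + (-1 : ℝ) • M.wedge2 Z W), M.wedge2 X Y + (-1 : ℝ) • M.wedge2 Z W⟫_ℝ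
  rw [abs_le]
  constructor <;> linarith

lemma eq_zero_of_isPosSemidef (M : ExtModel V E2 E4) {ω : E4}
    (h : IsPosSemidef (M.toOp ω)) : ω = 0 := by
  have key : ∀ e : E4, ⟪ω, e⟫_ℝ = 0 := by
    intro e
    have he : e ∈ Submodule.span ℝ {ω : E4 | ∃ X Y Z W : V, ω = M.wedge4 X Y Z W} := by
      rw [M.span_wedge4]
      trivial
    induction he using Submodule.span_induction with
    | mem x hx =>
      obtain ⟨X, Y, Z, W, rfl⟩ := hx
      simpa using M.abs_inner_wedge4_le 0 (by simpa using h) X Y Z W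
    | zero => exact inner_zero_right _
    | add x y _ _ hx hy => rw [inner_add_right, hx, hy, add_zero]
    | smul a x _ hx => rw [real_inner_smul_right, hx, mul_zero]
  exact inner_self_eq_zero.1 (key ω)

end ExtModel

lemma IsPosDef.isPosSemidef {E : Type*} [NormedAddCommGroup E] [InnerProductSpace ℝ E]
    {T : E →ₗ[ℝ] E} (h : IsPosDef T) : IsPosSemidef T := by
  intro v
  rcases eq_or_ne v 0 with rfl | hv
  · simp
  · exact (h v hv).le

/-- A subset of a finite-dimensional inner product space is bounded as soon as the functionals
`⟪·, e⟫`, for `e` in a spanning set, are bounded on it. -/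
lemma isBounded_of_forall_inner_le_of_span_eq_top {E : Type*} [NormedAddCommGroup E]
    [InnerProductSpace ℝ E] [FiniteDimensional ℝ E] {S A : Set E}
    (hA : Submodule.span ℝ A = ⊤) (h : ∀ e ∈ A, ∃ C : ℝ, ∀ x ∈ S, |⟪x, e⟫_ℝ| ≤ C) :
    Bornology.IsBounded S := by
  have key : ∀ e : E, ∃ C : ℝ, ∀ x ∈ S, |⟪x, e⟫_ℝ| ≤ C := by
    intro e
    have he : e ∈ Submodule.span ℝ A := by
      rw [hA]
      trivial
    induction he using Submodule.span_induction with
    | mem e he => exact h e he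
    | zero => exact ⟨0, by simp⟩
    | add e f _ _ he hf =>
      obtain ⟨C, hC⟩ := he
      obtain ⟨D, hD⟩ := hf
      refine ⟨C + D, fun x hx => ?_⟩
      rw [inner_add_right]
      exact (abs_add_le _ _).trans (add_le_add (hC x hx) (hD x hx))
    | smul a e _ he =>
      obtain ⟨C, hC⟩ := he
      refine ⟨|a| * C, fun x hx => ?_⟩
      rw [real_inner_smul_right, abs_mul]
      exact mul_le_mul_of_nonneg_left (hC x hx) (abs_nonneg a)
  choose C hC using key
  let b := stdOrthonormalBasis ℝ E
  refine isBounded_iff_forall_norm_le.2 ⟨∑ i, C (b i), fun x hx => ?_⟩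
  calc ‖x‖ = ‖∑ i, ⟪b i, x⟫_ℝ • b i‖ := by rw [b.sum_repr']
    _ ≤ ∑ i, ‖⟪b i, x⟫_ℝ • b i‖ := norm_sum_le _ _
    _ ≤ ∑ i, C (b i) := Finset.sum_le_sum fun i _ => by
      rw [norm_smul, b.norm_eq_one, mul_one, Real.norm_eq_abs, real_inner_comm]
      exact hC (b i) x hx

/-- If `ω ∈ Λ⁴V` induces a positive-semidefinite operator on
`Λ²V`, then `ω = 0`. Consequently, for any self-adjoint operator `R` on
`Λ²V`, the set `{ω ∈ Λ⁴V : R + ω is positive-definite}` is convex and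
bounded. -/
theorem posSemidef_form_eq_zero_and_convex_bounded
    {V E2 E4 : Type*}
    [NormedAddCommGroup V] [InnerProductSpace ℝ V] [FiniteDimensional ℝ V]
    [NormedAddCommGroup E2] [InnerProductSpace ℝ E2] [FiniteDimensional ℝ E2]
    [NormedAddCommGroup E4] [InnerProductSpace ℝ E4] [FiniteDimensional ℝ E4]
    (M : ExtModel V E2 E4) :
    (∀ ω : E4, IsPosSemidef (M.toOp ω) → ω = 0) ∧
    (∀ R : E2 →ₗ[ℝ] E2, R.IsSymmetric →
      Convex ℝ {ω : E4 | IsPosDef (R + M.toOp ω)} ∧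
      Bornology.IsBounded {ω : E4 | IsPosDef (R + M.toOp ω)}) := by
  refine ⟨fun ω h => M.eq_zero_of_isPosSemidef h, fun R _ => ⟨?_, ?_⟩⟩
  · intro ω hω η hη a b ha hb hab v hv
    have hω' := hω v hv
    have hη' := hη v hv
    have heq : ⟪(R + M.toOp (a • ω + b • η)) v, v⟫_ℝ
        = a * ⟪(R + M.toOp ω) v, v⟫_ℝ + b * ⟪(R + M.toOp η) v, v⟫_ℝ := by
      simp only [map_add, map_smul, LinearMap.add_apply, LinearMap.smul_apply, inner_add_left,
        real_inner_smul_left]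
      linear_combination (-⟪R v, v⟫_ℝ) * hab
    rw [heq]
    exact convex_Ioi (0 : ℝ) hω' hη' ha hb hab
  · refine isBounded_of_forall_inner_le_of_span_eq_top M.span_wedge4 ?_
    rintro _ ⟨X, Y, Z, W, rfl⟩
    exact ⟨_, fun ω hω => M.abs_inner_wedge4_le R (IsPosDef.isPosSemidef hω) X Y Z W⟩
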